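/- Let N ≥ 3, 2* = 2N/(N−2), let a ∈ ℝ^N, δ > 0, and let Q be a C² real-valued function on B_{2δ}(a) with ∇Q(a) = 0. There exists a constant C > 0 such that for all x ∈ ℝ^N with |x − a| ≤ δ and all λ ≥ 1, ( ∫_{B_δ(a)} ( |Q(y) − Q(a)| · U_{x,λ}(y)^{2*−1} )^{2N/(N+2)} dy )^{(N+2)/(2N)} ≤ C ( λ^{−2} + |x − a|² ). -/

import Mathlib

open MeasureTheory Metric Real Filter Topology Set

noncomputable section

/-- The critical Sobolev exponent `2* = 2N/(N-2)`. -/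
def twoStar (N : ℕ) : ℝ := 2 * N / ((N : ℝ) - 2)

/-- The Laplacian of `u : ℝ^N → ℝ`, as the sum of the second partial derivatives
in the coordinate directions. -/
def laplacian {N : ℕ} (u : EuclideanSpace ℝ (Fin N) → ℝ)
    (x : EuclideanSpace ℝ (Fin N)) : ℝ :=
  ∑ i : Fin N,
    fderiv ℝ (fun y => fderiv ℝ u y (EuclideanSpace.single i 1)) x (EuclideanSpace.single i 1)

/-- The Aubin–Talenti bubble
`U_{x,λ}(y) = (N(N-2))^{(N-2)/4} λ^{(N-2)/2} (1 + λ²|y-x|²)^{-(N-2)/2}`. -/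
def bubble (N : ℕ) (x : EuclideanSpace ℝ (Fin N)) (lam : ℝ)
    (y : EuclideanSpace ℝ (Fin N)) : ℝ :=
  ((N : ℝ) * ((N : ℝ) - 2)) ^ (((N : ℝ) - 2) / 4) * lam ^ (((N : ℝ) - 2) / 2) /
    (1 + lam ^ 2 * ‖y - x‖ ^ 2) ^ (((N : ℝ) - 2) / 2)

/-- A `C²` function with a critical point at `a` differs from its value at `a` by at most a
multiple of the squared distance to `a`, on a strictly smaller ball. -/
theorem exists_abs_sub_le_mul_norm_sq_of_fderiv_eq_zero
    {E : Type*} [NormedAddCommGroup E] [NormedSpace ℝ E] [ProperSpace E]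
    {f : E → ℝ} {a : E} {r R : ℝ} (hr : 0 ≤ r) (hrR : r < R)
    (hf : ContDiffOn ℝ 2 f (ball a R)) (hfa : fderiv ℝ f a = 0) :
    ∃ K, 0 ≤ K ∧ ∀ y ∈ closedBall a r, |f y - f a| ≤ K * ‖y - a‖ ^ 2 := by
  have hsub : closedBall a r ⊆ ball a R := closedBall_subset_ball hrR
  have hf' : ContDiffOn ℝ 1 (fderiv ℝ f) (ball a R) :=
    hf.fderiv_of_isOpen isOpen_ball (by norm_num)
  have hf'' : ContinuousOn (fderiv ℝ (fderiv ℝ f)) (closedBall a r) :=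
    (hf'.continuousOn_fderiv_of_isOpen isOpen_ball le_rfl).mono hsub
  obtain ⟨K, hK⟩ := (isCompact_closedBall a r).exists_bound_of_continuousOn
    (f := fderiv ℝ (fderiv ℝ f)) hf''
  have hK0 : 0 ≤ K := (norm_nonneg _).trans (hK a (mem_closedBall_self hr))
  have hgrad : ∀ y ∈ closedBall a r, ‖fderiv ℝ f y‖ ≤ K * ‖y - a‖ := by
    intro y hy
    have := (convex_closedBall a r).norm_image_sub_le_of_norm_fderiv_le
      (fun z hz => (hf'.differentiableOn one_ne_zero).differentiableAt
        (isOpen_ball.mem_nhds (hsub hz))) hK (mem_closedBall_self hr) hy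
    simpa [hfa] using this
  refine ⟨K, hK0, fun y hy => ?_⟩
  have hsub' : closedBall a ‖y - a‖ ⊆ closedBall a r :=
    closedBall_subset_closedBall (by rwa [← dist_eq_norm])
  have := (convex_closedBall a ‖y - a‖).norm_image_sub_le_of_norm_fderiv_le
    (C := K * ‖y - a‖)
    (fun z hz => (hf.differentiableOn two_ne_zero).differentiableAt
      (isOpen_ball.mem_nhds (hsub (hsub' hz))))
    (fun z hz => (hgrad z (hsub' hz)).trans
      (mul_le_mul_of_nonneg_left (by rwa [← dist_eq_norm z a]) hK0))
    (mem_closedBall_self (norm_nonneg _)) (by rw [mem_closedBall, dist_eq_norm])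
  rw [Real.norm_eq_abs] at this
  linarith

/-- The `L¹` invariance of the rescaling `g ↦ lam ^ N * g (lam • (· - x))`. -/
theorem integral_pow_mul_comp_smul_sub {N : ℕ} (g : EuclideanSpace ℝ (Fin N) → ℝ)
    (x : EuclideanSpace ℝ (Fin N)) {lam : ℝ} (hlam : 0 < lam) :
    ∫ y, lam ^ N * g (lam • (y - x)) = ∫ y, g y := by
  rw [integral_const_mul, integral_sub_right_eq_self (fun y => g (lam • y)) x,
    Measure.integral_comp_smul_of_nonneg _ _ _ (hR := hlam.le)]
  simp only [finrank_euclideanSpace, Fintype.card_fin, smul_eq_mul]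
  rw [mul_inv_cancel_left₀ (pow_pos hlam N).ne']

theorem bubble_rpow_twoStar_sub_one_rpow {N : ℕ} (hN : 3 ≤ N)
    (x y : EuclideanSpace ℝ (Fin N)) {lam : ℝ} (hlam : 0 < lam) :
    (bubble N x lam y ^ (twoStar N - 1)) ^ ((2 * (N : ℝ)) / ((N : ℝ) + 2)) =
      ((N : ℝ) * ((N : ℝ) - 2)) ^ ((N : ℝ) / 2) * lam ^ N *
        (1 + ‖lam • (y - x)‖ ^ 2) ^ (-(N : ℝ)) := by
  have hN' : (3 : ℝ) ≤ N := by exact_mod_cast hN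
  have h2 : (N : ℝ) - 2 ≠ 0 := by linarith
  have hc : 0 ≤ (N : ℝ) * ((N : ℝ) - 2) := mul_nonneg (by linarith) (by linarith)
  have hs : 0 ≤ 1 + ‖lam • (y - x)‖ ^ 2 := by positivity
  have hnorm : lam ^ 2 * ‖y - x‖ ^ 2 = ‖lam • (y - x)‖ ^ 2 := by
    rw [norm_smul, Real.norm_eq_abs, mul_pow, sq_abs]
  have hexp : (twoStar N - 1) * ((2 * (N : ℝ)) / ((N : ℝ) + 2)) = 2 * N / ((N : ℝ) - 2) := by
    unfold twoStar
    field_simp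
    ring
  unfold bubble
  rw [hnorm, ← Real.rpow_mul (by positivity), hexp, Real.div_rpow (by positivity) (by positivity),
    Real.mul_rpow (by positivity) (by positivity), ← Real.rpow_mul hc, ← Real.rpow_mul hlam.le,
    ← Real.rpow_mul hs, Real.rpow_neg hs, div_eq_mul_inv]
  have e1 : ((N : ℝ) - 2) / 4 * (2 * N / ((N : ℝ) - 2)) = N / 2 := by
    field_simp
    ring
  have e2 : ((N : ℝ) - 2) / 2 * (2 * N / ((N : ℝ) - 2)) = N := by
    field_simp
  rw [e1, e2, Real.rpow_natCast lam N]

/-- **Estimate (3.13) (bubble version).** Let `Q ∈ C²(B_{2δ}(a))` with `∇Q(a) = 0`.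
Then there is `C > 0` such that for `|x - a| ≤ δ` and `λ ≥ 1`,
`‖ |Q - Q(a)| U_{x,λ}^{2*-1} ‖_{L^{2N/(N+2)}(B_δ(a))} ≤ C (λ^{-2} + |x-a|²)`. -/
theorem potential_error_Lnorm_estimate
    (N : ℕ) (hN : 3 ≤ N)
    (a : EuclideanSpace ℝ (Fin N)) (δ : ℝ) (hδ : 0 < δ)
    (Q : EuclideanSpace ℝ (Fin N) → ℝ)
    (hQ : ContDiffOn ℝ 2 Q (Metric.ball a (2 * δ)))
    (hQa : fderiv ℝ Q a = 0) :
    ∃ C > 0, ∀ x : EuclideanSpace ℝ (Fin N), ‖x - a‖ ≤ δ →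
      ∀ lam : ℝ, 1 ≤ lam →
        (∫ y in Metric.ball a δ,
            (|Q y - Q a| * bubble N x lam y ^ (twoStar N - 1)) ^
              ((2 * (N : ℝ)) / ((N : ℝ) + 2))) ^ (((N : ℝ) + 2) / (2 * (N : ℝ)))
          ≤ C * (lam ^ (-2 : ℤ) + ‖x - a‖ ^ 2) := by
  have hN' : (3 : ℝ) ≤ N := by exact_mod_cast hN
  obtain ⟨K, hK0, hK⟩ := exists_abs_sub_le_mul_norm_sq_of_fderiv_eq_zero hδ.le
    (by linarith : δ < 2 * δ) hQ hQa
  set p : ℝ := (2 * (N : ℝ)) / ((N : ℝ) + 2) with hp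
  have hp0 : 0 < p := by positivity
  have hpinv : ((N : ℝ) + 2) / (2 * (N : ℝ)) = p⁻¹ := by rw [hp, inv_div]
  have hpN : 2 * p < N := by
    rw [hp, ← mul_div_assoc, div_lt_iff₀ (by positivity)]
    nlinarith
  set c : ℝ := ((N : ℝ) * ((N : ℝ) - 2)) ^ ((N : ℝ) / 2) with hc
  have hc0 : 0 ≤ c := Real.rpow_nonneg (mul_nonneg (by linarith) (by linarith)) _
  set g : EuclideanSpace ℝ (Fin N) → ℝ := fun w => (1 + ‖w‖ ^ 2) ^ (p - N) with hg
  have hg0 : ∀ w, 0 ≤ g w := fun w => by positivity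
  have hgint : Integrable g := by
    have := integrable_rpow_neg_one_add_norm_sq (E := EuclideanSpace ℝ (Fin N)) (μ := volume)
      (r := 2 * (N - p)) (by rw [finrank_euclideanSpace, Fintype.card_fin]; linarith)
    convert this using 3
    ring
  set I : ℝ := ∫ w, g w with hI
  have hI0 : 0 ≤ I := integral_nonneg hg0
  refine ⟨2 * K * (c * I) ^ p⁻¹ + 1, by positivity, fun x _ lam hlam => ?_⟩
  have hlam0 : 0 < lam := by linarith
  set D : ℝ := lam ^ (-2 : ℤ) + ‖x - a‖ ^ 2 with hD
  have hD0 : 0 ≤ D := by positivity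
  have hgint' : Integrable fun y => lam ^ N * g (lam • (y - x)) :=
    (((integrable_comp_smul_iff volume g hlam0.ne').2 hgint).comp_sub_right x).const_mul _
  have hbub : ∀ y, 0 ≤ bubble N x lam y := fun y => by
    have : 0 ≤ (N : ℝ) * ((N : ℝ) - 2) := mul_nonneg (by linarith) (by linarith)
    unfold bubble
    positivity
  have hpt : ∀ y ∈ ball a δ, (|Q y - Q a| * bubble N x lam y ^ (twoStar N - 1)) ^ p ≤
      (2 * K * D) ^ p * c * (lam ^ N * g (lam • (y - x))) := by
    intro y hy
    set s : ℝ := 1 + ‖lam • (y - x)‖ ^ 2 with hs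
    have hs1 : 1 ≤ s := le_add_of_nonneg_right (by positivity)
    have hs0 : 0 < s := by linarith
    have hdist : ‖y - a‖ ^ 2 ≤ 2 * D * s := by
      have htri : ‖y - a‖ ≤ ‖y - x‖ + ‖x - a‖ := norm_sub_le_norm_sub_add_norm_sub y x a
      have hyx : ‖y - x‖ ^ 2 ≤ lam ^ (-2 : ℤ) * s := by
        rw [hs, norm_smul, Real.norm_eq_abs, mul_pow, sq_abs, mul_add, ← mul_assoc,
          show lam ^ (-2 : ℤ) * lam ^ 2 = 1 by
            rw [zpow_neg]; exact inv_mul_cancel₀ (by positivity), one_mul]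
        exact le_add_of_nonneg_left (by positivity)
      have hxa : ‖x - a‖ ^ 2 ≤ ‖x - a‖ ^ 2 * s := le_mul_of_one_le_right (by positivity) hs1
      have hsq : ‖y - a‖ ^ 2 ≤ (‖y - x‖ + ‖x - a‖) ^ 2 := by gcongr
      rw [hD]
      nlinarith [sq_nonneg (‖y - x‖ - ‖x - a‖)]
    have hQy : |Q y - Q a| ≤ 2 * K * D * s :=
      (hK y (ball_subset_closedBall hy)).trans
        ((mul_le_mul_of_nonneg_left hdist hK0).trans_eq (by ring))
    rw [Real.mul_rpow (abs_nonneg _) (Real.rpow_nonneg (hbub y) _),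
      bubble_rpow_twoStar_sub_one_rpow hN x y hlam0]
    calc |Q y - Q a| ^ p * (c * lam ^ N * s ^ (-(N : ℝ)))
        ≤ (2 * K * D * s) ^ p * (c * lam ^ N * s ^ (-(N : ℝ))) := by gcongr
      _ = (2 * K * D) ^ p * c * (lam ^ N * g (lam • (y - x))) := by
        have : g (lam • (y - x)) = s ^ p * s ^ (-(N : ℝ)) := by
          rw [← Real.rpow_add hs0, ← sub_eq_add_neg]
        rw [this, Real.mul_rpow (by positivity) hs0.le]
        ring
  have hnn : ∀ y, 0 ≤ (|Q y - Q a| * bubble N x lam y ^ (twoStar N - 1)) ^ p := fun y =>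
    Real.rpow_nonneg (mul_nonneg (abs_nonneg _) (Real.rpow_nonneg (hbub y) _)) _
  have hint : ∫ y in ball a δ, (|Q y - Q a| * bubble N x lam y ^ (twoStar N - 1)) ^ p ≤
      (2 * K * D) ^ p * (c * I) := by
    calc ∫ y in ball a δ, (|Q y - Q a| * bubble N x lam y ^ (twoStar N - 1)) ^ p
        ≤ ∫ y in ball a δ, (2 * K * D) ^ p * c * (lam ^ N * g (lam • (y - x))) :=
          integral_mono_of_nonneg (ae_of_all _ hnn) (hgint'.const_mul _).integrableOn
            ((ae_restrict_iff' measurableSet_ball).2 (ae_of_all _ hpt))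
      _ ≤ ∫ y, (2 * K * D) ^ p * c * (lam ^ N * g (lam • (y - x))) :=
          setIntegral_le_integral (hgint'.const_mul _) (ae_of_all _ fun y =>
            mul_nonneg (by positivity) (mul_nonneg (by positivity) (hg0 _)))
      _ = (2 * K * D) ^ p * (c * I) := by
          rw [integral_const_mul, integral_pow_mul_comp_smul_sub g x hlam0, mul_assoc]
  rw [hpinv]
  calc (∫ y in ball a δ, (|Q y - Q a| * bubble N x lam y ^ (twoStar N - 1)) ^ p) ^ p⁻¹
      ≤ ((2 * K * D) ^ p * (c * I)) ^ p⁻¹ :=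
        Real.rpow_le_rpow (integral_nonneg hnn) hint (by positivity)
    _ = 2 * K * (c * I) ^ p⁻¹ * D := by
        rw [Real.mul_rpow (by positivity) (by positivity),
          Real.rpow_rpow_inv (by positivity) hp0.ne']
        ring
    _ ≤ (2 * K * (c * I) ^ p⁻¹ + 1) * D := by
        gcongr
        linarith

end
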